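/- Let T be an invertible measure-preserving transformation of the unit interval [0,1] with Lebesgue measure μ such that T^n is ergodic for every n ≥ 1 (completely ergodic). Then there exists an increasing sequence (a_n) of positive reals with a_n → ∞ and a_n/n → 0 such that for every binary partition P = {E, [0,1]∖E} with 0 < μ(E) < 1, one has liminf_{n→∞} H(η, P_n)/a_n = ∞, where η(x) = −x log₂ x; in particular, lim_{n→∞} H(η, P_n) = ∞ for every such partition. -/

import Mathlib

open MeasureTheory Filter Set

/-- The atom of the join partition `P ∨ T⁻¹P ∨ ⋯ ∨ T^{-(n-1)}P` of the binary partition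
`{E, Eᶜ}` corresponding to the 01-name `s`. -/
def cyl {X : Type*} (T : X → X) (E : Set X) (n : ℕ) (s : Fin n → Bool) : Set X :=
  {x | ∀ i : Fin n, (T^[(i : ℕ)] x ∈ E ↔ s i = true)}

/-- The `g`-entropy `H(g, P_n)` of the join partition `P_n` of the binary partition
`P = {E, Eᶜ}`. -/
noncomputable def binEnt {X : Type*} [MeasurableSpace X] (μ : Measure X)
    (T : X → X) (g : ℝ → ℝ) (E : Set X) (n : ℕ) : ℝ :=
  ∑ s : Fin n → Bool, g ((μ (cyl T E n s)).toReal)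

/-- The Shannon function `η(x) = −x·log₂ x`. -/
noncomputable def shannonF : ℝ → ℝ := fun x => -(x * Real.logb 2 x)

/-- A diagonal choice: if each of countably many sequences of contractions converges pointwise to
a contraction of a separable space, then so does a sequence that passes from one to the next
slowly enough. -/
theorem exists_diagonal_tendsto {V : Type*} [PseudoMetricSpace V] [TopologicalSpace.SeparableSpace V]
    [Nonempty V] (Φ : ℕ → ℕ → V → V) (hΦ : ∀ k n, LipschitzWith 1 (Φ k n)) (L : V → V)
    (hL : LipschitzWith 1 L) (h : ∀ k v, Tendsto (fun n => Φ k n v) atTop (nhds (L v))) :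
    ∃ κ : ℕ → ℕ, Monotone κ ∧ (∀ n, κ n ≤ n) ∧ Tendsto κ atTop atTop ∧
      ∀ v, Tendsto (fun n => Φ (κ n) n v) atTop (nhds (L v)) := by
  classical
  set d := TopologicalSpace.denseSeq V
  let R : ℕ → ℕ → Prop := fun k n => ∀ j ∈ Finset.range k, dist (Φ k n (d j)) (L (d j)) < 1 / (k + 1)
  have hR : ∀ k, ∀ᶠ n in atTop, R k n := fun k => by
    rw [Filter.eventually_all_finset]
    intro j _
    exact (h k (d j)).eventually (Metric.ball_mem_nhds _ Nat.one_div_pos_of_nat)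
  let κ : ℕ → ℕ := fun n => Nat.findGreatest (fun k => ∀ n' ≥ n, R k n') n
  have hκR : ∀ n, R (κ n) n := fun n =>
    Nat.findGreatest_spec (P := fun k => ∀ n' ≥ n, R k n') (Nat.zero_le n)
      (fun n' _ j hj => by simp at hj) n le_rfl
  have hκ : Tendsto κ atTop atTop := by
    rw [tendsto_atTop]
    intro K
    obtain ⟨N, hN⟩ := eventually_atTop.1 (hR K)
    filter_upwards [eventually_ge_atTop N, eventually_ge_atTop K] with n hn hK
    exact Nat.le_findGreatest hK fun n' hn' => hN n' (hn.trans hn')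
  refine ⟨κ, fun m n hmn => Nat.findGreatest_mono (fun k hk n' hn' => hk n' (hmn.trans hn')) hmn,
    fun n => Nat.findGreatest_le n, hκ, fun v => ?_⟩
  rw [Metric.tendsto_nhds]
  intro ε hε
  obtain ⟨j, hj⟩ := (TopologicalSpace.denseRange_denseSeq V).exists_dist_lt v (show 0 < ε / 3 by linarith)
  have h1 : Tendsto (fun n => 1 / ((κ n : ℝ) + 1)) atTop (nhds 0) :=
    tendsto_one_div_add_atTop_nhds_zero_nat.comp hκ
  filter_upwards [h1.eventually (gt_mem_nhds (show 0 < ε / 3 by linarith)),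
    hκ.eventually (eventually_gt_atTop j)] with n hn hjn
  have e1 := (hΦ (κ n) n).dist_le_mul v (d j)
  have e2 := hL.dist_le_mul (d j) v
  have e3 := hκR n j (Finset.mem_range.2 hjn)
  have e4 := dist_triangle4 (Φ (κ n) n v) (Φ (κ n) n (d j)) (L (d j)) (L v)
  rw [dist_comm (d j) v] at e2
  simp only [NNReal.coe_one, one_mul] at e1 e2
  linarith

theorem LipschitzWith.birkhoffAverage_id {V : Type*} [NormedAddCommGroup V] [NormedSpace ℝ V]
    {f : V → V} (hf : LipschitzWith 1 f) (n : ℕ) :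
    LipschitzWith 1 (birkhoffAverage ℝ f _root_.id n) := by
  refine LipschitzWith.of_dist_le_mul fun x y => ?_
  rw [NNReal.coe_one, one_mul]
  rcases Nat.eq_zero_or_pos n with rfl | hn
  · simp
  refine (dist_birkhoffAverage_birkhoffAverage_le ℝ f _root_.id n x y).trans ?_
  rw [div_le_iff₀ (by exact_mod_cast hn)]
  refine (Finset.sum_le_card_nsmul _ _ (dist x y) fun i _ => ?_).trans ?_
  · simpa using (hf.iterate i).dist_le_mul x y
  · simp [mul_comm]

section Koopman

variable {X : Type*} [MeasurableSpace X] {μ : Measure X}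

/-- The Koopman operator of a measure-preserving map on `L²`. -/
noncomputable def koopman {f : X → X} (hf : MeasurePreserving f μ μ) : Lp ℝ 2 μ →ₗᵢ[ℝ] Lp ℝ 2 μ :=
  Lp.compMeasurePreservingₗᵢ ℝ f hf

theorem koopman_coeFn {f : X → X} (hf : MeasurePreserving f μ μ) (g : Lp ℝ 2 μ) :
    koopman hf g =ᵐ[μ] g ∘ f :=
  Lp.coeFn_compMeasurePreserving g hf

theorem koopman_iterate_coeFn {f : X → X} (hf : MeasurePreserving f μ μ) (g : Lp ℝ 2 μ) (i : ℕ) :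
    (koopman hf)^[i] g =ᵐ[μ] g ∘ f^[i] := by
  induction i with
  | zero => rfl
  | succ i ih =>
    rw [Function.iterate_succ_apply', Function.iterate_succ]
    exact (koopman_coeFn hf _).trans (hf.quasiMeasurePreserving.ae_eq_comp ih)

theorem birkhoffAverage_koopman_coeFn {f : X → X} (hf : MeasurePreserving f μ μ) (g : Lp ℝ 2 μ)
    (m : ℕ) : ⇑(birkhoffAverage ℝ (koopman hf) _root_.id m g) =ᵐ[μ] birkhoffAverage ℝ f g m := by
  have hsum : ∀ m, ⇑(birkhoffSum (koopman hf) _root_.id m g) =ᵐ[μ] birkhoffSum f g m := by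
    intro m
    induction m with
    | zero => simpa [birkhoffSum_zero, birkhoffSum_zero'] using Lp.coeFn_zero ℝ 2 μ
    | succ m ih =>
      rw [birkhoffSum_succ]
      filter_upwards [Lp.coeFn_add (birkhoffSum (koopman hf) _root_.id m g)
        (_root_.id ((koopman hf)^[m] g)), ih, koopman_iterate_coeFn hf g m] with x h1 h2 h3
      rw [h1, birkhoffSum_succ, Pi.add_apply, h2, _root_.id, h3, Function.comp_apply]
  filter_upwards [Lp.coeFn_smul (m : ℝ)⁻¹ (birkhoffSum (koopman hf) _root_.id m g), hsum m]
    with x h1 h2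
  rw [birkhoffAverage, h1, birkhoffAverage, Pi.smul_apply, h2]

/-- The mean ergodic theorem for an ergodic map: the averages converge to the projection onto the
constants. -/
theorem tendsto_birkhoffAverage_koopman [IsProbabilityMeasure μ] {f : X → X} (hf : Ergodic f μ)
    (g : Lp ℝ 2 μ) :
    Tendsto (fun n => birkhoffAverage ℝ (koopman hf.toMeasurePreserving) _root_.id n g) atTop
      (nhds ((ℝ ∙ (Lp.const 2 μ (1 : ℝ))).starProjection g)) := by
  set U := koopman hf.toMeasurePreserving
  have h := U.toContinuousLinearMap.tendsto_birkhoffAverage_orthogonalProjection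
    U.norm_toContinuousLinearMap_le g
  have key : U.toContinuousLinearMap.eqLocus (1 : Lp ℝ 2 μ →L[ℝ] Lp ℝ 2 μ)
      = (ℝ ∙ (Lp.const 2 μ (1 : ℝ))) := by
    ext v
    rw [Submodule.mem_span_singleton, LinearMap.mem_eqLocus]
    constructor
    · intro hv
      have hv' : U v = v := hv
      have h1 : v ∘ f =ᵐ[μ] v := by
        have := koopman_coeFn hf.toMeasurePreserving v
        change U v =ᵐ[μ] v ∘ f at this
        rw [hv'] at this
        exact this.symm
      obtain ⟨c, hc⟩ := hf.ae_eq_const_of_ae_eq_comp_ae (Lp.aestronglyMeasurable v) h1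
      refine ⟨c, Lp.ext ?_⟩
      filter_upwards [hc, Lp.coeFn_smul c (Lp.const 2 μ (1 : ℝ)), Lp.coeFn_const 2 μ (1 : ℝ)]
        with x h1 h2 h3
      rw [h1, h2, Pi.smul_apply, h3]
      simp
    · rintro ⟨c, rfl⟩
      change U (c • _) = c • _
      rw [map_smul]
      congr 1
  have congr_proj : ∀ (K K' : Submodule ℝ (Lp ℝ 2 μ)) [K.HasOrthogonalProjection]
      [K'.HasOrthogonalProjection], K = K' → K.starProjection g = K'.starProjection g := by
    rintro K _ _ _ rfl
    rfl
  rw [← congr_proj _ _ key]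
  exact h

theorem starProjection_const_indicator [IsProbabilityMeasure μ] {E : Set X} (hE : MeasurableSet E) :
    (ℝ ∙ (Lp.const 2 μ (1 : ℝ))).starProjection
      (indicatorConstLp 2 hE (measure_ne_top μ E) (1 : ℝ)) = Lp.const 2 μ (μ.real E) := by
  rw [Submodule.starProjection_unit_singleton]
  · rw [← indicatorConstLp_univ, L2.inner_indicatorConstLp_one, Measure.restrict_univ,
      integral_indicatorConstLp, indicatorConstLp_univ, smul_eq_mul, mul_one]
    simpa using ((Lp.constₗ 2 μ ℝ).map_smul (μ.real E) (1 : ℝ)).symm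
  · simp [Lp.norm_const]

end Koopman

section Entropy

theorem pairwise_disjoint_cyl {X : Type*} {T : X → X} {E : Set X} (n : ℕ) :
    Pairwise (Function.onFun Disjoint (cyl T E n)) := by
  intro s t hst
  refine Set.disjoint_left.2 fun x hs ht => hst (funext fun i => ?_)
  rw [Bool.eq_iff_iff]
  exact (hs i).symm.trans (ht i)

theorem iUnion_cyl {X : Type*} {T : X → X} {E : Set X} (n : ℕ) : ⋃ s, cyl T E n s = univ := by
  classical
  exact eq_univ_of_forall fun x =>
    mem_iUnion.2 ⟨fun i => decide (T^[(i : ℕ)] x ∈ E), fun i => by simp⟩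

variable {X : Type*} [MeasurableSpace X] {μ : Measure X} {T : X → X} {E : Set X}

theorem measurableSet_cyl (hT : Measurable T) (hE : MeasurableSet E) (n : ℕ) (s : Fin n → Bool) :
    MeasurableSet (cyl T E n s) := by
  rw [cyl, ofPred_forall]
  refine MeasurableSet.iInter fun i => ?_
  by_cases h : s i = true
  · simp only [h, iff_true]
    exact hT.iterate i hE
  · simp only [h, Bool.false_eq_true, iff_false]
    exact (hT.iterate i hE).compl

theorem sum_measureReal_cyl [IsProbabilityMeasure μ] (hT : Measurable T) (hE : MeasurableSet E)
    (n : ℕ) : ∑ s, μ.real (cyl T E n s) = 1 := by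
  rw [← measureReal_iUnion_fintype (pairwise_disjoint_cyl n) (measurableSet_cyl hT hE n),
    iUnion_cyl, probReal_univ]

theorem shannonF_nonneg {x : ℝ} (h0 : 0 ≤ x) (h1 : x ≤ 1) : 0 ≤ shannonF x := by
  rw [shannonF, Left.nonneg_neg_iff]
  exact mul_nonpos_of_nonneg_of_nonpos h0 (Real.logb_nonpos one_lt_two h0 h1)

theorem mul_le_shannonF {x : ℝ} {k : ℕ} (h0 : 0 ≤ x) (hx : x ≤ (4 ^ k)⁻¹) :
    2 * k * x ≤ shannonF x := by
  rcases h0.eq_or_lt with rfl | h0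
  · simp [shannonF]
  have h : Real.logb 2 x ≤ -(2 * k) := by
    rw [Real.logb_le_iff_le_rpow one_lt_two h0, Real.rpow_neg zero_le_two]
    convert hx using 2
    rw [Real.rpow_mul zero_le_two, Real.rpow_natCast]
    norm_num
  rw [shannonF]
  nlinarith

/-- If the atoms of measure more than `4⁻ᵏ` are confined to a set of measure less than `1 / 2`,
then the entropy is at least `k`. -/
theorem le_binEnt_of_heavy_subset [IsProbabilityMeasure μ] (hT : Measurable T)
    (hE : MeasurableSet E) {n k : ℕ} {B : Set X}
    (hB : ∀ s, (4 ^ k)⁻¹ < μ.real (cyl T E n s) → cyl T E n s ⊆ B) (hμB : μ.real B < 1 / 2) :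
    (k : ℝ) ≤ binEnt μ T shannonF E n := by
  classical
  let heavy : (Fin n → Bool) → Prop := fun s => (4 ^ k)⁻¹ < μ.real (cyl T E n s)
  have h1 : ∑ s with heavy s, μ.real (cyl T E n s) ≤ μ.real B := by
    rw [← measureReal_biUnion_finset (fun s _ t _ hst => pairwise_disjoint_cyl n hst)
      (fun s _ => measurableSet_cyl hT hE n s)]
    exact measureReal_mono (iUnion₂_subset fun s hs => hB s (Finset.mem_filter.1 hs).2)
  have h2 := Finset.sum_filter_add_sum_filter_not Finset.univ heavy
    (fun s => μ.real (cyl T E n s))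
  rw [sum_measureReal_cyl hT hE] at h2
  have h3 : 2 * k * ∑ s with ¬ heavy s, μ.real (cyl T E n s) ≤ binEnt μ T shannonF E n := by
    rw [Finset.mul_sum]
    calc _ ≤ ∑ s with ¬ heavy s, shannonF (μ.real (cyl T E n s)) :=
          Finset.sum_le_sum fun s hs =>
            mul_le_shannonF measureReal_nonneg (not_lt.1 (Finset.mem_filter.1 hs).2)
      _ ≤ ∑ s, shannonF (μ.real (cyl T E n s)) :=
          Finset.sum_le_sum_of_subset_of_nonneg (Finset.filter_subset _ _) fun s _ _ =>
            shannonF_nonneg measureReal_nonneg measureReal_le_one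
  have h4 : (0 : ℝ) ≤ k := k.cast_nonneg
  nlinarith

/-- The name of an atom of measure more than `4⁻ᵏ` has a period at most `4ᵏ`, because the atom
returns to itself within that time. -/
theorem exists_period_of_heavy [IsProbabilityMeasure μ] (hT : MeasurePreserving T μ μ)
    (hE : MeasurableSet E) {n k : ℕ} {s : Fin n → Bool}
    (hs : (4 ^ k)⁻¹ < μ.real (cyl T E n s)) :
    ∃ p, 0 < p ∧ p ≤ 4 ^ k ∧ ∀ (i : ℕ) (hi : i + p < n), s ⟨i + p, hi⟩ = s ⟨i, by omega⟩ := by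
  have h : μ univ < ((4 ^ k + 1 : ℕ) : ENNReal) * μ (cyl T E n s) := by
    rw [← ENNReal.toReal_lt_toReal (measure_ne_top _ _) (ENNReal.mul_ne_top (by simp)
      (measure_ne_top _ _)), ENNReal.toReal_mul]
    change μ.real univ < _ * μ.real _
    rw [probReal_univ, ENNReal.toReal_natCast]
    push_cast
    have h4 : (0 : ℝ) < 4 ^ k := by positivity
    rw [inv_lt_iff_one_lt_mul₀' h4] at hs
    nlinarith [measureReal_nonneg (μ := μ) (s := cyl T E n s)]
  obtain ⟨x, hx, p, hp, hxp⟩ := hT.exists_mem_iterate_mem_of_measure_univ_lt_mul_measure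
    (measurableSet_cyl hT.measurable hE n s).nullMeasurableSet h
  refine ⟨p, hp.1, Nat.lt_succ_iff.1 hp.2, fun i hi => ?_⟩
  rw [Bool.eq_iff_iff]
  have h1 := hx ⟨i + p, hi⟩
  have h2 := hxp ⟨i, by omega⟩
  rw [← Function.iterate_add_apply] at h2
  exact h1.symm.trans h2

/-- All atoms of measure more than `4⁻ᵏ` have names of the common period `(4ᵏ)!`, so the ergodic
averages of the indicator of `E` along this period are trivial on them. -/
theorem birkhoffAverage_indicator_of_heavy [IsProbabilityMeasure μ] (hT : MeasurePreserving T μ μ)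
    (hE : MeasurableSet E) {n k : ℕ} {s : Fin n → Bool}
    (hs : (4 ^ k)⁻¹ < μ.real (cyl T E n s)) {x : X} (hx : x ∈ cyl T E n s) :
    birkhoffAverage ℝ T^[(4 ^ k).factorial] (E.indicator fun _ => (1 : ℝ))
      (n / (4 ^ k).factorial) x ∈ ({0, 1} : Set ℝ) := by
  obtain ⟨p, hp, hpk, hper⟩ := exists_period_of_heavy hT hE hs
  obtain ⟨r, hr⟩ := Nat.dvd_factorial hp hpk
  set q := (4 ^ k).factorial
  set m := n / q
  have hq : 0 < q := Nat.factorial_pos _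
  have hmul : ∀ j (hj : p * j < n), s ⟨p * j, hj⟩ = s ⟨0, by omega⟩ := by
    intro j
    induction j with
    | zero => intro _; rfl
    | succ j ih => exact fun hj => (hper (p * j) hj).trans (ih _)
  have hval : ∀ i < m, E.indicator (fun _ => (1 : ℝ)) ((T^[q])^[i] x)
      = E.indicator (fun _ => (1 : ℝ)) x := by
    intro i hi
    have hin : q * i < n := by
      calc q * i < q * m := Nat.mul_lt_mul_of_pos_left hi hq
        _ ≤ n := Nat.mul_div_le n q
    have h1 := hx ⟨q * i, hin⟩
    have h2 := hx ⟨0, by omega⟩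
    have h3 : s ⟨q * i, hin⟩ = s ⟨0, by omega⟩ := by
      simpa [hr, mul_assoc] using hmul (r * i) (by rwa [← mul_assoc, ← hr])
    rw [h3] at h1
    have h4 : (T^[q])^[i] x ∈ E ↔ x ∈ E := by
      rw [← Function.iterate_mul]
      exact h1.trans h2.symm
    by_cases h : x ∈ E
    · rw [indicator_of_mem h, indicator_of_mem (h4.2 h)]
    · rw [indicator_of_notMem h, indicator_of_notMem (mt h4.1 h)]
  rcases Nat.eq_zero_or_pos m with h0 | h0
  · simp [h0]
  rw [birkhoffAverage, birkhoffSum, Finset.sum_congr rfl fun i hi => hval i (Finset.mem_range.1 hi)]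
  have h0' : (m : ℝ) ≠ 0 := by positivity
  by_cases h : x ∈ E <;> simp [h, h0']

/-- A completely ergodic transformation has a universal lower bound, tending to infinity, for the
entropies of the join partitions of all nontrivial binary partitions. -/
theorem exists_eventually_le_binEnt [IsProbabilityMeasure μ] [IsSeparable μ]
    (herg : ∀ n : ℕ, 1 ≤ n → Ergodic T^[n] μ) :
    ∃ κ : ℕ → ℕ, Monotone κ ∧ (∀ n, κ n ≤ n) ∧ Tendsto κ atTop atTop ∧
      ∀ E : Set X, MeasurableSet E → 0 < μ E → μ E < 1 →
        ∀ᶠ n in atTop, (κ n : ℝ) ≤ binEnt μ T shannonF E n := by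
  have hT : MeasurePreserving T μ μ := by simpa using (herg 1 le_rfl).toMeasurePreserving
  have : Fact ((2 : ENNReal) ≠ ⊤) := ⟨ENNReal.ofNat_ne_top⟩
  have hpos : ∀ k : ℕ, 0 < (4 ^ k).factorial := fun k => Nat.factorial_pos _
  let U : ∀ k : ℕ, Lp ℝ 2 μ →ₗᵢ[ℝ] Lp ℝ 2 μ := fun k =>
    koopman (herg _ (hpos k)).toMeasurePreserving
  obtain ⟨κ, hmono, hle, hκ, hlim⟩ := exists_diagonal_tendsto
    (fun k n => birkhoffAverage ℝ (U k) _root_.id (n / (4 ^ k).factorial))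
    (fun k n => (U k).lipschitz.birkhoffAverage_id _)
    (fun g => (ℝ ∙ (Lp.const 2 μ (1 : ℝ))).starProjection g)
    (LipschitzWith.of_dist_le_mul fun x y => by
      rw [dist_eq_norm, ← map_sub, dist_eq_norm, NNReal.coe_one, one_mul]
      exact Submodule.norm_starProjection_apply_le _ _)
    (fun k g => (tendsto_birkhoffAverage_koopman (herg _ (hpos k)) g).comp
      (Nat.tendsto_div_const_atTop (hpos k).ne'))
  refine ⟨κ, hmono, hle, hκ, fun E hE h0 h1 => ?_⟩
  have hc0 : 0 < μ.real E := ENNReal.toReal_pos h0.ne' (measure_ne_top _ _)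
  have hc1 : μ.real E < 1 := by
    simpa [Measure.real] using (ENNReal.toReal_lt_toReal (measure_ne_top _ _) ENNReal.one_ne_top).2 h1
  obtain ⟨δ, hδ, hδ0, hδ1⟩ : ∃ δ : ℝ, 0 < δ ∧ δ ≤ μ.real E ∧ δ ≤ 1 - μ.real E :=
    ⟨min (μ.real E) (1 - μ.real E), lt_min hc0 (by linarith), min_le_left _ _, min_le_right _ _⟩
  set g := indicatorConstLp 2 hE (measure_ne_top μ E) (1 : ℝ)
  have hmeas := tendstoInMeasure_of_tendsto_Lp (hlim g)
  rw [starProjection_const_indicator hE] at hmeas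
  have hev := (tendstoInMeasure_iff_norm.1 hmeas δ hδ).eventually
    (gt_mem_nhds (show (0 : ENNReal) < ENNReal.ofReal (1 / 2) by simp))
  filter_upwards [hev] with n hn
  refine le_binEnt_of_heavy_subset hT.measurable hE
    (B := birkhoffAverage ℝ T^[(4 ^ κ n).factorial] (E.indicator fun _ => (1 : ℝ))
      (n / (4 ^ κ n).factorial) ⁻¹' {0, 1})
    (fun s hs x hx => mem_preimage.2 <| birkhoffAverage_indicator_of_heavy hT hE hs hx) ?_
  rw [Measure.real]
  refine (ENNReal.lt_ofReal_iff_toReal_lt (measure_ne_top _ _)).1 (lt_of_le_of_lt ?_ hn)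
  refine measure_mono_ae ?_
  filter_upwards [birkhoffAverage_koopman_coeFn (herg _ (hpos (κ n))).toMeasurePreserving g
      (n / (4 ^ κ n).factorial),
    (herg _ (hpos (κ n))).quasiMeasurePreserving.birkhoffAverage_ae_eq_of_ae_eq ℝ
      (indicatorConstLp_coeFn (p := 2) (hs := hE) (hμs := measure_ne_top μ E) (c := (1 : ℝ)))
      (n / (4 ^ κ n).factorial),
    Lp.coeFn_const 2 μ (μ.real E)] with x e1 e2 e3 hx
  change δ ≤ ‖_ - _‖
  change _ ∈ _ at hx
  rw [e3]
  change birkhoffAverage ℝ (U (κ n)) _root_.id _ g x = _ at e1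
  rw [e1, e2, Function.const_apply, Real.norm_eq_abs]
  rcases hx with hx | hx
  · rw [hx, zero_sub, abs_neg, abs_of_pos hc0]
    exact hδ0
  · rw [mem_singleton_iff.1 hx, abs_of_pos (by linarith)]
    exact hδ1

end Entropy

theorem tendsto_div_sqrt_add_two_atTop :
    Tendsto (fun x : ℝ => x / (Real.sqrt x + 2)) atTop atTop := by
  refine tendsto_atTop_mono' _ ?_ (Real.tendsto_sqrt_atTop.atTop_div_const (show (0 : ℝ) < 3 by norm_num))
  filter_upwards [eventually_ge_atTop 1] with x hx
  have h := Real.one_le_sqrt.2 hx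
  rw [div_le_div_iff₀ (by norm_num) (by linarith)]
  nlinarith [Real.sq_sqrt (show 0 ≤ x by linarith)]

/-- For every invertible, completely ergodic measure-preserving transformation of the unit
interval with Lebesgue measure, there exists an increasing sequence `(aₙ)` of positive
reals with `aₙ → ∞`, `aₙ/n → 0`, such that every nontrivial binary partition `{E, Eᶜ}`
satisfies `liminf H(η, Pₙ)/aₙ = ∞`; in particular `H(η, Pₙ) → ∞`. -/
theorem statement6 (T : Set.Icc (0:ℝ) 1 → Set.Icc (0:ℝ) 1)
    (hT : MeasurePreserving T volume volume)
    (hinv : ∃ S : Set.Icc (0:ℝ) 1 → Set.Icc (0:ℝ) 1,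
      Measurable S ∧ Function.LeftInverse S T ∧ Function.RightInverse S T)
    (herg : ∀ n : ℕ, 1 ≤ n → Ergodic (T^[n]) volume) :
    ∃ a : ℕ → ℝ, StrictMono a ∧ (∀ n, 0 < a n) ∧
      Tendsto a atTop atTop ∧ Tendsto (fun n => a n / n) atTop (nhds 0) ∧
      (∀ E : Set (Set.Icc (0:ℝ) 1), MeasurableSet E → 0 < volume E → volume E < 1 →
        Tendsto (fun n => binEnt volume T shannonF E n / a n) atTop atTop) ∧
      (∀ E : Set (Set.Icc (0:ℝ) 1), MeasurableSet E → 0 < volume E → volume E < 1 →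
        Tendsto (fun n => binEnt volume T shannonF E n) atTop atTop) := by
  obtain ⟨κ, hmono, hle, hκ, hent⟩ :=
    exists_eventually_le_binEnt (μ := (volume : Measure (Set.Icc (0:ℝ) 1))) herg
  have hκ' : Tendsto (fun n => (κ n : ℝ)) atTop atTop := tendsto_natCast_atTop_atTop.comp hκ
  have hinv_le : ∀ n : ℕ, 0 < 1 / ((n : ℝ) + 1) ∧ 1 / ((n : ℝ) + 1) ≤ 1 := fun n =>
    ⟨Nat.one_div_pos_of_nat, by
      rw [div_le_one (by positivity)]; linarith [(n.cast_nonneg : (0 : ℝ) ≤ n)]⟩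
  set a : ℕ → ℝ := fun n => Real.sqrt (κ n) + (2 - 1 / ((n : ℝ) + 1)) with ha
  have ha_pos : ∀ n, 0 < a n := fun n => by
    have := Real.sqrt_nonneg (κ n)
    simp only [ha]; linarith [hinv_le n]
  have ha_le : ∀ n, a n ≤ Real.sqrt (κ n) + 2 := fun n => by
    simp only [ha]; linarith [hinv_le n]
  refine ⟨a, fun m n hmn => ?_, ha_pos, ?_, ?_, fun E hE h0 h1 => ?_, fun E hE h0 h1 => ?_⟩
  · refine add_lt_add_of_le_of_lt (Real.sqrt_le_sqrt (by exact_mod_cast hmono hmn.le)) ?_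
    have := Nat.one_div_lt_one_div (α := ℝ) hmn
    linarith
  · refine tendsto_atTop_mono (fun n => ?_) (Real.tendsto_sqrt_atTop.comp hκ')
    simp only [ha, Function.comp_apply]; linarith [hinv_le n]
  · have h1 : Tendsto (fun n : ℕ => (Real.sqrt n)⁻¹ + 2 / n) atTop (nhds 0) := by
      simpa using ((Real.tendsto_sqrt_atTop.comp tendsto_natCast_atTop_atTop).inv_tendsto_atTop).add
        (tendsto_const_div_atTop_nhds_zero_nat (2 : ℝ))
    refine squeeze_zero (fun n => div_nonneg (ha_pos n).le n.cast_nonneg) (fun n => ?_) h1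
    rw [← Real.sqrt_div_self, ← add_div]
    refine div_le_div_of_nonneg_right ((ha_le n).trans ?_) n.cast_nonneg
    have := Real.sqrt_le_sqrt (show (κ n : ℝ) ≤ n by exact_mod_cast hle n)
    linarith
  · refine tendsto_atTop_mono' _ ?_ (tendsto_div_sqrt_add_two_atTop.comp hκ')
    filter_upwards [hent E hE h0 h1] with n hn
    exact div_le_div₀ ((κ n).cast_nonneg.trans hn) hn (ha_pos n) (ha_le n)
  · exact tendsto_atTop_mono' _ (hent E hE h0 h1) hκ'
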